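/- Let F_q be a finite field with char F_q = 2 and let α be a nonzero element of F_q. Then the L_q^1-TD contains no (4,2) absorbing set configuration: there do not exist four pairwise distinct blocks B_1, B_2, B_3, B_4 such that B_3 ∩ B_4 = ∅, each of the remaining five pairs of blocks intersects in exactly one point, and these five intersection points are pairwise distinct. -/

import Mathlib

/-- The block `B(x,y)` of the `𝓛_q^1`-TD with scale factor `α`:
`B(x,y) = {(x,1), (y,2), (α·x+y,3)}`, the three groups being indexed by `Fin 3`. -/
def blk3 {F : Type*} [Field F] (α : F) (xy : F × F) : Set (F × Fin 3) :=
  {(xy.1, (0 : Fin 3)), (xy.2, (1 : Fin 3)), (α * xy.1 + xy.2, (2 : Fin 3))}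

/-- In the `(4,2)` configuration the pair `{B₃, B₄}` (indices `{2,3}`) is the unique
non-intersecting pair of blocks; all other pairs of blocks meet. -/
def meetingPair (i j : Fin 4) : Prop :=
  ¬((i = 2 ∧ j = 3) ∨ (i = 3 ∧ j = 2))

/-- The coordinates of the block `B(x,y)`, the first one scaled by `α`. -/
def blockCoord {F : Type*} [Field F] (α : F) (xy : F × F) : Fin 3 → F :=
  ![α * xy.1, xy.2, α * xy.1 + xy.2]

/-- In characteristic two the three scaled coordinates of a block sum to zero. -/
theorem blockCoord_sum_eq_zero {F : Type*} [Field F] [CharP F 2] (α : F) (xy : F × F)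
    {g h k : Fin 3} (hgh : g ≠ h) (hgk : g ≠ k) (hhk : h ≠ k) :
    blockCoord α xy g + blockCoord α xy h + blockCoord α xy k = 0 := by
  have h2 : (2 : F) = 0 := CharTwo.two_eq_zero
  fin_cases g <;> fin_cases h <;> fin_cases k <;> simp [blockCoord] at * <;>
    linear_combination (α * xy.1 + xy.2) * h2

/-- Two points of the same group on the same block coincide. -/
theorem eq_of_mem_blk3 {F : Type*} [Field F] {α : F} {xy : F × F} {p q : F × Fin 3}
    (hp : p ∈ blk3 α xy) (hq : q ∈ blk3 α xy) (h : p.2 = q.2) : p = q := by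
  simp only [blk3, Set.mem_insert_iff, Set.mem_singleton_iff] at hp hq
  rcases hp with rfl | rfl | rfl <;> rcases hq with rfl | rfl | rfl <;> simp_all

/-- Blocks through a common point agree in the coordinate given by its group. -/
theorem blockCoord_eq_of_mem {F : Type*} [Field F] {α : F} {xy zw : F × F} {p : F × Fin 3}
    (hp : p ∈ blk3 α xy) (hq : p ∈ blk3 α zw) :
    blockCoord α xy p.2 = blockCoord α zw p.2 := by
  simp only [blk3, Set.mem_insert_iff, Set.mem_singleton_iff] at hp hq
  rcases hp with rfl | rfl | rfl <;> simp_all [blockCoord]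

/-- Blocks that agree in some coordinate meet. -/
theorem inter_nonempty_of_blockCoord_eq {F : Type*} [Field F] {α : F} (hα : α ≠ 0)
    {xy zw : F × F} {g : Fin 3} (h : blockCoord α xy g = blockCoord α zw g) :
    (blk3 α xy ∩ blk3 α zw).Nonempty := by
  fin_cases g
  · exact ⟨(xy.1, 0), by simp_all [blk3, blockCoord]⟩
  · exact ⟨(xy.2, 1), by simp_all [blk3, blockCoord]⟩
  · exact ⟨(α * xy.1 + xy.2, 2), by simp_all [blk3, blockCoord]⟩

/-- If `char F = 2`, then the `𝓛_q^1`-TD contains no `(4,2)` absorbing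
set configuration: there are no four pairwise distinct blocks `B₁, B₂, B₃, B₄` with
`B₃ ∩ B₄ = ∅`, each of the remaining five pairs of blocks meeting in exactly one point,
and those five intersection points pairwise distinct. -/
theorem ltd1_no_42_absorbing_set {F : Type*} [Field F] [Fintype F]
    (α : F) (hα : α ≠ 0) (hchar : ringChar F = 2) :
    ¬ ∃ (b : Fin 4 → F × F) (pt : Fin 4 → Fin 4 → F × Fin 3),
        Function.Injective b ∧
        blk3 α (b 2) ∩ blk3 α (b 3) = ∅ ∧
        (∀ i j : Fin 4, i ≠ j → meetingPair i j →
            blk3 α (b i) ∩ blk3 α (b j) = {pt i j}) ∧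
        (∀ i j k l : Fin 4, i < j → k < l → meetingPair i j → meetingPair k l →
            (i, j) ≠ (k, l) → pt i j ≠ pt k l) := by
  rintro ⟨b, pt, -, hdisj, hmeet, hne⟩
  have : CharP F 2 := hchar ▸ ringChar.charP F
  have hmem : ∀ i j : Fin 4, i ≠ j → meetingPair i j →
      pt i j ∈ blk3 α (b i) ∧ pt i j ∈ blk3 α (b j) := fun i j hij hm =>
    (hmeet i j hij hm).symm.subset rfl
  obtain ⟨h01, h01'⟩ := hmem 0 1 (by decide) (by simp [meetingPair])
  obtain ⟨h02, h02'⟩ := hmem 0 2 (by decide) (by simp [meetingPair])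
  obtain ⟨h03, h03'⟩ := hmem 0 3 (by decide) (by simp [meetingPair])
  obtain ⟨h12, h12'⟩ := hmem 1 2 (by decide) (by simp [meetingPair])
  obtain ⟨h13, h13'⟩ := hmem 1 3 (by decide) (by simp [meetingPair])
  have hgroup : ∀ {i j k l m : Fin 4}, pt i j ∈ blk3 α (b m) → pt k l ∈ blk3 α (b m) →
      i < j → k < l → meetingPair i j → meetingPair k l → (i, j) ≠ (k, l) →
      (pt i j).2 ≠ (pt k l).2 := fun hp hq hij hkl hm hm' hn h =>
    hne _ _ _ _ hij hkl hm hm' hn (eq_of_mem_blk3 hp hq h)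
  have n1 : (pt 0 1).2 ≠ (pt 0 2).2 := by
    apply hgroup h01 h02 <;> simp [meetingPair]
  have n2 : (pt 0 1).2 ≠ (pt 0 3).2 := by
    apply hgroup h01 h03 <;> simp [meetingPair]
  have n3 : (pt 0 2).2 ≠ (pt 0 3).2 := by
    apply hgroup h02 h03 <;> simp [meetingPair]
  have n4 : (pt 0 1).2 ≠ (pt 1 2).2 := by
    apply hgroup h01' h12 <;> simp [meetingPair]
  have n5 : (pt 0 1).2 ≠ (pt 1 3).2 := by
    apply hgroup h01' h13 <;> simp [meetingPair]
  have n6 : (pt 0 2).2 ≠ (pt 1 2).2 := by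
    apply hgroup h02' h12' <;> simp [meetingPair]
  have n7 : (pt 0 3).2 ≠ (pt 1 3).2 := by
    apply hgroup h03' h13' <;> simp [meetingPair]
  have e12 : (pt 1 2).2 = (pt 0 3).2 := by omega
  have e13 : (pt 1 3).2 = (pt 0 2).2 := by omega
  have c01 := blockCoord_eq_of_mem h01 h01'
  have c02 := blockCoord_eq_of_mem h02 h02'
  have c03 := blockCoord_eq_of_mem h03 h03'
  have c12 := blockCoord_eq_of_mem h12 h12'
  have c13 := blockCoord_eq_of_mem h13 h13'
  rw [e12] at c12
  rw [e13] at c13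
  have s := fun i => blockCoord_sum_eq_zero α (b i) n1 n2 n3
  have h2 : (2 : F) = 0 := CharTwo.two_eq_zero
  have key : blockCoord α (b 2) (pt 0 1).2 = blockCoord α (b 3) (pt 0 1).2 := by
    linear_combination s 2 - s 3 + s 0 - s 1 - c01 + c02 + c12 - c03 - c13
      - (blockCoord α (b 0) (pt 0 2).2 - blockCoord α (b 1) (pt 0 2).2) * h2
  exact (inter_nonempty_of_blockCoord_eq hα key).ne_empty hdisj
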